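/- Let k ≥ 2 be an integer, let G be a finite simple graph, let P be a k^+-star packing of G satisfying conditions (C1), (C2), (C3), (C4) and (C5), and let Q be any k^+-star packing of G. Then every Type-2 star of Q (a star of Q exactly k−1 of whose vertices are uncovered by P) contains at most one a-vertex. -/

import Mathlib

open SimpleGraph

variable {V : Type*}

/-- A star in a graph `G`: a center together with a finite set of satellites, each
adjacent to the center.  An `ℓ`-star is such a star with `sats.card = ℓ`. -/
structure GStar (G : SimpleGraph V) where
  center : V
  sats : Finset V
  center_not_mem : center ∉ sats
  adj : ∀ v ∈ sats, G.Adj center v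

/-- The vertex set of a star. -/
def GStar.verts {G : SimpleGraph V} (S : GStar G) : Set V :=
  insert S.center ↑S.sats

/-- The set of vertices covered by a collection of stars. -/
def coverSet {G : SimpleGraph V} (P : Set (GStar G)) : Set V :=
  ⋃ S ∈ P, S.verts

/-- A `k⁺`-star packing: pairwise vertex-disjoint stars, each with at least `k` satellites. -/
def IsKPlusPacking {G : SimpleGraph V} (k : ℕ) (P : Set (GStar G)) : Prop :=
  (∀ S ∈ P, k ≤ S.sats.card) ∧
  P.Pairwise fun S T => Disjoint S.verts T.verts

/-- (C1) no vertex uncovered by `P` has `k` or more uncovered neighbors, and no uncovered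
vertex is adjacent to the center of a star of `P`. -/
def CondC1 {G : SimpleGraph V} (k : ℕ) (P : Set (GStar G)) : Prop :=
  ∀ v ∈ (coverSet P)ᶜ,
    (G.neighborSet v ∩ (coverSet P)ᶜ).ncard < k ∧
    ∀ S ∈ P, ¬ G.Adj v S.center

/-- (C2) for every star `S` of `P` with at least `k+1` satellites and every satellite `v`
of `S`, there is no `k⁺`-star of `G` whose vertex set lies in `{v} ∪ (V ∖ V(P))`. -/
def CondC2 {G : SimpleGraph V} (k : ℕ) (P : Set (GStar G)) : Prop :=
  ∀ S ∈ P, k + 1 ≤ S.sats.card → ∀ v ∈ S.sats,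
    ¬ ∃ T : GStar G, k ≤ T.sats.card ∧ T.verts ⊆ insert v (coverSet P)ᶜ

/-- (C3) for every star `S` of `P` with exactly `k` satellites, no `(k+1)⁺`-star and no
pair of vertex-disjoint `k`-stars fit inside `V(S) ∪ (V ∖ V(P))`. -/
def CondC3 {G : SimpleGraph V} (k : ℕ) (P : Set (GStar G)) : Prop :=
  ∀ S ∈ P, S.sats.card = k →
    (¬ ∃ T : GStar G, k + 1 ≤ T.sats.card ∧ T.verts ⊆ S.verts ∪ (coverSet P)ᶜ) ∧
    (¬ ∃ T₁ T₂ : GStar G, T₁.sats.card = k ∧ T₂.sats.card = k ∧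
        Disjoint T₁.verts T₂.verts ∧
        T₁.verts ⊆ S.verts ∪ (coverSet P)ᶜ ∧ T₂.verts ⊆ S.verts ∪ (coverSet P)ᶜ)

/-- (C4) for every `k`-star `S` of `P`, every `(k+1)⁺`-star `T` of `P` and every satellite
`x` of `T`, no pair of vertex-disjoint `k⁺`-stars fits inside `V(S) ∪ {x} ∪ (V ∖ V(P))`. -/
def CondC4 {G : SimpleGraph V} (k : ℕ) (P : Set (GStar G)) : Prop :=
  ∀ S ∈ P, S.sats.card = k → ∀ T ∈ P, k + 1 ≤ T.sats.card → ∀ x ∈ T.sats,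
    ¬ ∃ A B : GStar G, k ≤ A.sats.card ∧ k ≤ B.sats.card ∧
        Disjoint A.verts B.verts ∧
        A.verts ⊆ S.verts ∪ {x} ∪ (coverSet P)ᶜ ∧
        B.verts ⊆ S.verts ∪ {x} ∪ (coverSet P)ᶜ

/-- (C5) for every two distinct `k`-stars `S, T` of `P`, neither a vertex-disjoint pair
consisting of a `k⁺`-star and a `(k+1)⁺`-star, nor a triple of pairwise vertex-disjoint
`k`-stars, fits inside `V(S) ∪ V(T) ∪ (V ∖ V(P))`. -/
def CondC5 {G : SimpleGraph V} (k : ℕ) (P : Set (GStar G)) : Prop :=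
  ∀ S ∈ P, ∀ T ∈ P, S ≠ T → S.sats.card = k → T.sats.card = k →
    (¬ ∃ A B : GStar G, k ≤ A.sats.card ∧ k + 1 ≤ B.sats.card ∧
        Disjoint A.verts B.verts ∧
        A.verts ⊆ S.verts ∪ T.verts ∪ (coverSet P)ᶜ ∧
        B.verts ⊆ S.verts ∪ T.verts ∪ (coverSet P)ᶜ) ∧
    (¬ ∃ A B C : GStar G, A.sats.card = k ∧ B.sats.card = k ∧ C.sats.card = k ∧
        Disjoint A.verts B.verts ∧ Disjoint A.verts C.verts ∧ Disjoint B.verts C.verts ∧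
        A.verts ⊆ S.verts ∪ T.verts ∪ (coverSet P)ᶜ ∧
        B.verts ⊆ S.verts ∪ T.verts ∪ (coverSet P)ᶜ ∧
        C.verts ⊆ S.verts ∪ T.verts ∪ (coverSet P)ᶜ)

/-- (C6, for `k = 2`) for every three distinct `2`-stars `S, T, U` of `P`, no triple of
pairwise vertex-disjoint stars consisting of two `2`-stars and a `3⁺`-star fits inside
`V(S) ∪ V(T) ∪ V(U) ∪ (V ∖ V(P))`. -/
def CondC6 {G : SimpleGraph V} (P : Set (GStar G)) : Prop :=
  ∀ S ∈ P, ∀ T ∈ P, ∀ U ∈ P, S ≠ T → S ≠ U → T ≠ U →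
    S.sats.card = 2 → T.sats.card = 2 → U.sats.card = 2 →
    ¬ ∃ A B C : GStar G, A.sats.card = 2 ∧ B.sats.card = 2 ∧ 3 ≤ C.sats.card ∧
        Disjoint A.verts B.verts ∧ Disjoint A.verts C.verts ∧ Disjoint B.verts C.verts ∧
        A.verts ⊆ S.verts ∪ T.verts ∪ U.verts ∪ (coverSet P)ᶜ ∧
        B.verts ⊆ S.verts ∪ T.verts ∪ U.verts ∪ (coverSet P)ᶜ ∧
        C.verts ⊆ S.verts ∪ T.verts ∪ U.verts ∪ (coverSet P)ᶜ

/-- A Type-1 star of `Q` (with respect to `P`): exactly `k` of its vertices are uncovered by `P`. -/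
def IsType1Star {G : SimpleGraph V} (k : ℕ) (P : Set (GStar G)) (S : GStar G) : Prop :=
  (S.verts ∩ (coverSet P)ᶜ).ncard = k

/-- A `c`-vertex: a satellite of a Type-1 star of `Q` that is covered by `P`. -/
def IsCVertex {G : SimpleGraph V} (k : ℕ) (P Q : Set (GStar G)) (v : V) : Prop :=
  v ∈ coverSet P ∧ ∃ S ∈ Q, IsType1Star k P S ∧ v ∈ S.sats

/-- An `a`-vertex: a vertex covered by `P` that is not a `c`-vertex and belongs to a star
of `P` containing some `c`-vertex. -/
def IsAVertex {G : SimpleGraph V} (k : ℕ) (P Q : Set (GStar G)) (v : V) : Prop :=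
  v ∈ coverSet P ∧ ¬ IsCVertex k P Q v ∧
    ∃ T ∈ P, v ∈ T.verts ∧ ∃ c, IsCVertex k P Q c ∧ c ∈ T.verts

/-- The `a`-vertex `v` is associated with the `c`-vertex `c`: they lie in a common star of `P`. -/
def AVertexAssoc {G : SimpleGraph V} (k : ℕ) (P Q : Set (GStar G)) (v c : V) : Prop :=
  v ∈ coverSet P ∧ ¬ IsCVertex k P Q v ∧ IsCVertex k P Q c ∧
    ∃ T ∈ P, v ∈ T.verts ∧ c ∈ T.verts

open Classical in
/-- The satellites of `S` that are uncovered by `P`. -/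
noncomputable def uncoveredSats {G : SimpleGraph V} (P : Set (GStar G)) (S : GStar G) :
    Finset V :=
  S.sats.filter (· ∉ coverSet P)

/-- The star with center `c` and satellites `X`, all of them neighbors of `c`. -/
def GStar.ofAdj {G : SimpleGraph V} (c : V) (X : Finset V) (h : ∀ v ∈ X, G.Adj c v) :
    GStar G where
  center := c
  sats := X
  center_not_mem hc := G.loopless.irrefl c (h c hc)
  adj := h

section StarPackings

variable {G : SimpleGraph V} {k : ℕ} {P Q : Set (GStar G)} {S T : GStar G} {v a c : V}

theorem mem_uncoveredSats : v ∈ uncoveredSats P S ↔ v ∈ S.sats ∧ v ∉ coverSet P := by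
  simp [uncoveredSats]

theorem GStar.mem_verts : v ∈ S.verts ↔ v = S.center ∨ v ∈ S.sats := by
  simp [GStar.verts]

theorem GStar.mem_verts_ofAdj {X : Finset V} {h : ∀ v ∈ X, G.Adj c v} :
    v ∈ (GStar.ofAdj c X h).verts ↔ v = c ∨ v ∈ X :=
  GStar.mem_verts

theorem mem_coverSet : v ∈ coverSet P ↔ ∃ S ∈ P, v ∈ S.verts := by
  simp [coverSet]

theorem ncard_uncovered_of_center_mem (h : S.center ∈ coverSet P) :
    (S.verts ∩ (coverSet P)ᶜ).ncard = (uncoveredSats P S).card := by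
  rw [← Set.ncard_coe_finset]
  congr 1
  ext v
  simp only [Set.mem_inter_iff, GStar.mem_verts, Set.mem_compl_iff, Finset.mem_coe,
    mem_uncoveredSats]
  grind

theorem ncard_uncovered_of_center_not_mem (h : S.center ∉ coverSet P) :
    (S.verts ∩ (coverSet P)ᶜ).ncard = (uncoveredSats P S).card + 1 := by
  classical
  have hc : S.center ∉ uncoveredSats P S := fun h => S.center_not_mem (mem_uncoveredSats.1 h).1
  rw [← Finset.card_insert_of_notMem hc, ← Set.ncard_coe_finset]
  congr 1
  ext v
  simp only [Set.mem_inter_iff, GStar.mem_verts, Set.mem_compl_iff, Finset.mem_coe,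
    Finset.mem_insert, mem_uncoveredSats]
  grind

theorem IsKPlusPacking.eq_of_mem_verts (hP : IsKPlusPacking k P) (hS : S ∈ P) (hT : T ∈ P)
    (hvS : v ∈ S.verts) (hvT : v ∈ T.verts) : S = T := by
  by_contra h
  exact Set.disjoint_left.1 (hP.2 hS hT h) hvS hvT

theorem CondC1.mem_sats (h1 : CondC1 k P) (hT : T ∈ P) (hv : v ∈ T.verts) {u : V}
    (hu : u ∉ coverSet P) (huv : G.Adj u v) : v ∈ T.sats := by
  rcases GStar.mem_verts.1 hv with rfl | h
  · exact absurd huv ((h1 u hu).2 T hT)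
  · exact h

/-- The center of a Type-1 star is uncovered. -/
theorem IsType1Star.center_not_mem_coverSet (hk : 2 ≤ k) (hP : IsKPlusPacking k P)
    (h1 : CondC1 k P) (h2 : CondC2 k P) (h3 : CondC3 k P) (hS : IsType1Star k P S) :
    S.center ∉ coverSet P := by
  classical
  intro hc
  have hcard : (uncoveredSats P S).card = k := (ncard_uncovered_of_center_mem hc).symm.trans hS
  have hadj : ∀ v ∈ uncoveredSats P S, G.Adj S.center v :=
    fun v hv => S.adj v (mem_uncoveredSats.1 hv).1
  obtain ⟨T, hT, hcT⟩ := mem_coverSet.1 hc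
  obtain ⟨u, hu⟩ := Finset.card_pos.1 (show 0 < (uncoveredSats P S).card by lia)
  have hsat : S.center ∈ T.sats := h1.mem_sats hT hcT (mem_uncoveredSats.1 hu).2 (hadj u hu).symm
  rcases (hP.1 T hT).eq_or_lt with hTk | hTk
  · have hTc : T.center ∈ coverSet P := mem_coverSet.2 ⟨T, hT, GStar.mem_verts.2 (.inl rfl)⟩
    refine (h3 T hT hTk.symm).1 ⟨.ofAdj S.center (insert T.center (uncoveredSats P S)) ?_, ?_, ?_⟩
    · intro v hv
      rcases Finset.mem_insert.1 hv with rfl | hv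
      · exact (T.adj _ hsat).symm
      · exact hadj v hv
    · simp only [GStar.ofAdj]
      rw [Finset.card_insert_of_notMem fun h => (mem_uncoveredSats.1 h).2 hTc, hcard]
    · intro v
      simp only [GStar.mem_verts, GStar.ofAdj, Finset.mem_insert, mem_uncoveredSats,
        Set.mem_union, Set.mem_compl_iff]
      grind
  · refine h2 T hT hTk _ hsat ⟨.ofAdj S.center (uncoveredSats P S) hadj, hcard.ge, ?_⟩
    intro v
    simp only [GStar.mem_verts, GStar.ofAdj, mem_uncoveredSats, Set.mem_insert_iff,
      Set.mem_compl_iff]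
    grind

/-- A star of `P` containing a `c`-vertex has exactly `k` satellites, and the `c`-vertex
extends by uncovered vertices to a `k`-star inside the Type-1 star of `Q` it belongs to. -/
theorem IsCVertex.exists_star (hk : 2 ≤ k) (hP : IsKPlusPacking k P)
    (h1 : CondC1 k P) (h2 : CondC2 k P) (h3 : CondC3 k P) (hc : IsCVertex k P Q c)
    (hT : T ∈ P) (hcT : c ∈ T.verts) :
    T.sats.card = k ∧ ∃ R ∈ Q, IsType1Star k P R ∧ R.center ∉ coverSet P ∧
      c ∈ R.sats ∧ ∃ A : GStar G, A.sats.card = k ∧ A.verts ⊆ R.verts ∧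
        A.verts ⊆ insert c (coverSet P)ᶜ := by
  classical
  obtain ⟨hcP, R, hR, hR1, hcR⟩ := hc
  have hRc := hR1.center_not_mem_coverSet hk hP h1 h2 h3
  have hcard : (uncoveredSats P R).card + 1 = k :=
    (ncard_uncovered_of_center_not_mem hRc).symm.trans hR1
  have hsat : c ∈ T.sats := h1.mem_sats hT hcT hRc (R.adj c hcR)
  obtain ⟨A, hA, hAR, hAc⟩ : ∃ A : GStar G, A.sats.card = k ∧ A.verts ⊆ R.verts ∧
        A.verts ⊆ insert c (coverSet P)ᶜ := by
    refine ⟨.ofAdj R.center (insert c (uncoveredSats P R)) ?_, ?_, ?_, ?_⟩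
    · intro v hv
      rcases Finset.mem_insert.1 hv with rfl | hv
      · exact R.adj _ hcR
      · exact R.adj v (mem_uncoveredSats.1 hv).1
    · simp only [GStar.ofAdj]
      rw [Finset.card_insert_of_notMem fun h => (mem_uncoveredSats.1 h).2 hcP, hcard]
    · intro v
      simp only [GStar.mem_verts, GStar.ofAdj, Finset.mem_insert, mem_uncoveredSats]
      grind
    · intro v
      simp only [GStar.mem_verts, GStar.ofAdj, Finset.mem_insert, mem_uncoveredSats,
        Set.mem_insert_iff, Set.mem_compl_iff]
      grind
  refine ⟨?_, R, hR, hR1, hRc, hcR, A, hA, hAR, hAc⟩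
  rcases (hP.1 T hT).eq_or_lt with hTk | hTk
  · exact hTk.symm
  · exact absurd ⟨A, hA.ge, hAc⟩ (h2 T hT hTk c hsat)

/-- If the center of a Type-2 star of `Q` is covered, then no satellite of that star is an
`a`-vertex. -/
theorem not_isAVertex_of_center_mem_coverSet (hk : 2 ≤ k) (hP : IsKPlusPacking k P)
    (h1 : CondC1 k P) (h2 : CondC2 k P) (h3 : CondC3 k P) (h4 : CondC4 k P) (h5 : CondC5 k P)
    (hQ : IsKPlusPacking k Q) (hS : S ∈ Q) (hS2 : (S.verts ∩ (coverSet P)ᶜ).ncard = k - 1)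
    (hSc : S.center ∈ coverSet P) (haS : a ∈ S.sats) : ¬ IsAVertex k P Q a := by
  classical
  rintro ⟨haP, -, T, hT, haT, c, hc, hcT⟩
  obtain ⟨hTk, R, hR, hR1, -, hcR, A, hAk, hAR, hAc⟩ := hc.exists_star hk hP h1 h2 h3 hT hcT
  have hSR : Disjoint S.verts R.verts := by
    refine hQ.2 hS hR ?_
    rintro rfl
    rw [IsType1Star] at hR1
    lia
  have hcS : c ∉ S.verts := fun h => Set.disjoint_left.1 hSR h (GStar.mem_verts.2 (.inr hcR))
  have hcard : (uncoveredSats P S).card = k - 1 :=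
    (ncard_uncovered_of_center_mem hSc).symm.trans hS2
  have haU : a ∉ uncoveredSats P S := fun h => (mem_uncoveredSats.1 h).2 haP
  obtain ⟨W, hW, hcW⟩ := mem_coverSet.1 hSc
  obtain ⟨u, hu⟩ := Finset.card_pos.1 (show 0 < (uncoveredSats P S).card by lia)
  have hsat : S.center ∈ W.sats :=
    h1.mem_sats hW hcW (mem_uncoveredSats.1 hu).2 (S.adj u (mem_uncoveredSats.1 hu).1).symm
  have hAT : A.verts ⊆ T.verts ∪ (coverSet P)ᶜ := fun v hv => by
    rcases hAc hv with rfl | h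
    · exact .inl hcT
    · exact .inr h
  obtain ⟨B, hBk, hBS, hBa⟩ : ∃ B : GStar G, B.sats.card = k ∧ B.verts ⊆ S.verts ∧
      B.verts ⊆ {S.center, a} ∪ (coverSet P)ᶜ := by
    refine ⟨.ofAdj S.center (insert a (uncoveredSats P S)) ?_, ?_, ?_, ?_⟩
    · intro v hv
      rcases Finset.mem_insert.1 hv with rfl | hv
      · exact S.adj _ haS
      · exact S.adj v (mem_uncoveredSats.1 hv).1
    · simp only [GStar.ofAdj]
      rw [Finset.card_insert_of_notMem haU, hcard]
      lia
    · intro v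
      simp only [GStar.mem_verts, GStar.ofAdj, Finset.mem_insert, mem_uncoveredSats]
      grind
    · intro v
      simp only [GStar.mem_verts, GStar.ofAdj, Finset.mem_insert, mem_uncoveredSats,
        Set.mem_insert_iff, Set.mem_singleton_iff, Set.mem_union, Set.mem_compl_iff]
      grind
  have hAB : Disjoint A.verts B.verts := (hSR.symm.mono_left hAR).mono_right hBS
  by_cases hWT : W = T
  · subst hWT
    refine (h3 W hW hTk).2 ⟨A, B, hAk, hBk, hAB, hAT, fun v hv => ?_⟩
    rcases hBa hv with (rfl | rfl) | h
    · exact .inl hcW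
    · exact .inl haT
    · exact .inr h
  have hdisj := hP.2 hW hT hWT
  rcases (hP.1 W hW).eq_or_lt with hWk | hWk
  · have hwW : W.center ∈ W.verts := GStar.mem_verts.2 (.inl rfl)
    have hwP : W.center ∈ coverSet P := mem_coverSet.2 ⟨W, hW, hwW⟩
    have hwT : W.center ∉ T.verts := Set.disjoint_left.1 hdisj hwW
    have hwa : W.center ∉ insert a (uncoveredSats P S) := by
      intro h
      rcases Finset.mem_insert.1 h with h | h
      · exact hwT (h ▸ haT)
      · exact (mem_uncoveredSats.1 h).2 hwP
    refine (h5 W hW T hT hWT hWk.symm hTk).1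
      ⟨A, .ofAdj S.center (insert W.center (insert a (uncoveredSats P S))) ?_, hAk.ge, ?_, ?_,
        fun v hv => ?_, ?_⟩
    · intro v hv
      rcases Finset.mem_insert.1 hv with rfl | hv
      · exact (W.adj _ hsat).symm
      rcases Finset.mem_insert.1 hv with rfl | hv
      · exact S.adj _ haS
      · exact S.adj v (mem_uncoveredSats.1 hv).1
    · simp only [GStar.ofAdj]
      rw [Finset.card_insert_of_notMem hwa, Finset.card_insert_of_notMem haU, hcard]
      lia
    · rw [Set.disjoint_left]
      intro v hvA hvB
      have hvS : v ∉ S.verts := fun h => Set.disjoint_left.1 hSR h (hAR hvA)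
      simp only [GStar.mem_verts, GStar.ofAdj, Finset.mem_insert, mem_uncoveredSats] at hvB hvS
      obtain rfl : v = W.center := by grind
      rcases hAc hvA with h | h
      · exact hwT (h ▸ hcT)
      · exact h hwP
    · rcases hAT hv with h | h
      · exact .inl (.inr h)
      · exact .inr h
    · intro v
      simp only [GStar.mem_verts_ofAdj, Finset.mem_insert,
        mem_uncoveredSats, Set.mem_union, Set.mem_compl_iff]
      grind
  · refine h4 T hT hTk W hW hWk _ hsat ⟨A, B, hAk.ge, hBk.ge, hAB, fun v hv => ?_, fun v hv => ?_⟩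
    · rcases hAT hv with h | h
      · exact .inl (.inl h)
      · exact .inr h
    · rcases hBa hv with (rfl | rfl) | h
      · exact .inl (.inr rfl)
      · exact .inl (.inl haT)
      · exact .inr h

/-- If the center of a Type-2 star of `Q` is uncovered, then at most one satellite of that
star is an `a`-vertex. -/
theorem IsAVertex.eq_of_center_not_mem_coverSet (hk : 2 ≤ k) (hP : IsKPlusPacking k P)
    (h1 : CondC1 k P) (h2 : CondC2 k P) (h3 : CondC3 k P) (h5 : CondC5 k P)
    (hQ : IsKPlusPacking k Q) (hS : S ∈ Q) (hS2 : (S.verts ∩ (coverSet P)ᶜ).ncard = k - 1)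
    (hSc : S.center ∉ coverSet P) (haS : a ∈ S.sats) (ha : IsAVertex k P Q a)
    {b : V} (hbS : b ∈ S.sats) (hb : IsAVertex k P Q b) : a = b := by
  classical
  by_contra hab
  obtain ⟨haP, -, T, hT, haT, c, hc, hcT⟩ := ha
  obtain ⟨hbP, -, T', hT', hbT', d, hd, hdT'⟩ := hb
  have hcP := hc.1
  have hdP := hd.1
  obtain ⟨hTk, R, hR, hR1, hRc, hcR, A, hAk, hAR, hAc⟩ := hc.exists_star hk hP h1 h2 h3 hT hcT
  obtain ⟨hTk', R', hR', hR1', -, hdR', A', hAk', hAR', hAd⟩ :=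
    hd.exists_star hk hP h1 h2 h3 hT' hdT'
  have hdisj : ∀ R ∈ Q, IsType1Star k P R → Disjoint R.verts S.verts := by
    intro R hR hR1
    refine hQ.2 hR hS ?_
    rintro rfl
    rw [IsType1Star] at hR1
    lia
  have hcard : (uncoveredSats P S).card + 1 = k - 1 :=
    (ncard_uncovered_of_center_not_mem hSc).symm.trans hS2
  obtain ⟨B, hBk, hBS, hBa⟩ : ∃ B : GStar G, B.sats.card = k ∧ B.verts ⊆ S.verts ∧
      B.verts ⊆ {a, b} ∪ (coverSet P)ᶜ := by
    refine ⟨.ofAdj S.center (insert a (insert b (uncoveredSats P S))) ?_, ?_, ?_, ?_⟩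
    · intro v hv
      refine S.adj v ?_
      simp only [Finset.mem_insert, mem_uncoveredSats] at hv
      grind
    · simp only [GStar.ofAdj]
      rw [Finset.card_insert_of_notMem, Finset.card_insert_of_notMem]
      · lia
      · exact fun h => (mem_uncoveredSats.1 h).2 hbP
      · simp only [Finset.mem_insert, mem_uncoveredSats]
        tauto
    · intro v
      simp only [GStar.mem_verts, GStar.ofAdj, Finset.mem_insert, mem_uncoveredSats]
      grind
    · intro v
      simp only [GStar.mem_verts, GStar.ofAdj, Finset.mem_insert, mem_uncoveredSats,
        Set.mem_insert_iff, Set.mem_singleton_iff, Set.mem_union, Set.mem_compl_iff]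
      grind
  have hAB : Disjoint A.verts B.verts := ((hdisj R hR hR1).mono_left hAR).mono_right hBS
  have hAB' : Disjoint A'.verts B.verts := ((hdisj R' hR' hR1').mono_left hAR').mono_right hBS
  by_cases hTT : T = T'
  · subst hTT
    refine (h3 T hT hTk).2 ⟨A, B, hAk, hBk, hAB, fun v hv => ?_, fun v hv => ?_⟩
    · rcases hAc hv with rfl | h
      · exact .inl hcT
      · exact .inr h
    · rcases hBa hv with (rfl | rfl) | h
      · exact .inl haT
      · exact .inl hbT'
      · exact .inr h
  have hBT : B.verts ⊆ T.verts ∪ T'.verts ∪ (coverSet P)ᶜ := fun v hv => by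
    rcases hBa hv with (rfl | rfl) | h
    · exact .inl (.inl haT)
    · exact .inl (.inr hbT')
    · exact .inr h
  by_cases hRR : R = R'
  · subst hRR
    have hcd : c ≠ d := by
      rintro rfl
      exact hTT (hP.eq_of_mem_verts hT hT' hcT hdT')
    have hcardR : (uncoveredSats P R).card + 1 = k :=
      (ncard_uncovered_of_center_not_mem hRc).symm.trans hR1
    have hadj : ∀ v ∈ insert c (insert d (uncoveredSats P R)), G.Adj R.center v := by
      intro v hv
      refine R.adj v ?_
      simp only [Finset.mem_insert, mem_uncoveredSats] at hv
      grind
    refine (h5 T hT T' hT' hTT hTk hTk').1 ⟨B, .ofAdj R.center _ hadj, hBk.ge, ?_,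
      ((hdisj R hR hR1).symm.mono_left hBS).mono_right ?_, hBT, ?_⟩
    · simp only [GStar.ofAdj]
      rw [Finset.card_insert_of_notMem, Finset.card_insert_of_notMem, hcardR]
      · exact fun h => (mem_uncoveredSats.1 h).2 hdP
      · simp only [Finset.mem_insert, mem_uncoveredSats]
        tauto
    · intro v
      simp only [GStar.mem_verts, GStar.ofAdj, Finset.mem_insert, mem_uncoveredSats]
      grind
    · intro v
      simp only [GStar.mem_verts_ofAdj, Finset.mem_insert,
        mem_uncoveredSats, Set.mem_union, Set.mem_compl_iff]
      grind
  · refine (h5 T hT T' hT' hTT hTk hTk').2 ⟨A, A', B, hAk, hAk', hBk,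
      ((hQ.2 hR hR' hRR).mono_left hAR).mono_right hAR', hAB, hAB', fun v hv => ?_,
      fun v hv => ?_, hBT⟩
    · rcases hAc hv with rfl | h
      · exact .inl (.inl hcT)
      · exact .inr h
    · rcases hAd hv with rfl | h
      · exact .inl (.inr hdT')
      · exact .inr h

end StarPackings

/-- Lemma 5 of the paper: under (C1)–(C5), every Type-2 star of `Q` (a star of `Q`
exactly `k-1` of whose vertices are uncovered by `P`) contains at most one `a`-vertex. -/
theorem type2_at_most_one_avertex [Fintype V] (G : SimpleGraph V) (k : ℕ) (hk : 2 ≤ k)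
    (P : Set (GStar G)) (hP : IsKPlusPacking k P)
    (h1 : CondC1 k P) (h2 : CondC2 k P) (h3 : CondC3 k P)
    (h4 : CondC4 k P) (h5 : CondC5 k P)
    (Q : Set (GStar G)) (hQ : IsKPlusPacking k Q) :
    ∀ S ∈ Q, (S.verts ∩ (coverSet P)ᶜ).ncard = k - 1 →
      (S.verts ∩ {a | IsAVertex k P Q a}).ncard ≤ 1 := by
  intro S hS hS2
  rw [Set.ncard_le_one]
  rintro a ⟨haS, ha⟩ b ⟨hbS, hb⟩
  by_cases hSc : S.center ∈ coverSet P
  · have hcenter : ∀ v ∈ S.verts, IsAVertex k P Q v → v = S.center := fun v hv hav =>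
      (GStar.mem_verts.1 hv).resolve_right fun h =>
        not_isAVertex_of_center_mem_coverSet hk hP h1 h2 h3 h4 h5 hQ hS hS2 hSc h hav
    rw [hcenter a haS ha, hcenter b hbS hb]
  · have hsat : ∀ v ∈ S.verts, IsAVertex k P Q v → v ∈ S.sats := fun v hv hav =>
      (GStar.mem_verts.1 hv).resolve_left fun h => hSc (h ▸ hav.1)
    exact ha.eq_of_center_not_mem_coverSet hk hP h1 h2 h3 h5 hQ hS hS2 hSc
      (hsat a haS ha) (hsat b hbS hb) hb
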